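/- Let 𝓕 be a family of cinematic functions over a compact interval J with cinematic constant K. Let 𝓡 be a finite family of pairwise 100-incomparable (δ,t)-rectangles R = f^δ(I) with f ∈ 𝓕, such that all the functions f arising in 𝓡 are contained in a single ball of radius 3t in C²(J). Then for every C ≥ 100 there is a constant c = c(C,K) > 0 and a pairwise C-incomparable subcollection 𝓡′ ⊆ 𝓡 with #𝓡′ ≥ c·#𝓡. -/

import Mathlib

open Set

/-- The `C²(J)` distance between two functions. -/
noncomputable def c2dist (J : Set ℝ) (f g : ℝ → ℝ) : ℝ :=
  sSup ((fun θ => |f θ - g θ| + |deriv f θ - deriv g θ| +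
      |deriv (deriv f) θ - deriv (deriv g) θ|) '' J)

/-- `λ·[u,v]`: the interval concentric with `[u,v]` of `λ` times the length. -/
def subIcc (lam u v : ℝ) : Set ℝ :=
  Set.Icc ((u + v) / 2 - lam * (v - u) / 2) ((u + v) / 2 + lam * (v - u) / 2)

/-- The curvilinear region of vertical thickness `δ` about the graph of `f`
over the set `S`. -/
def rectOn (f : ℝ → ℝ) (δ : ℝ) (S : Set ℝ) : Set (ℝ × ℝ) :=
  {x : ℝ × ℝ | x.1 ∈ S ∧ |x.2 - f x.1| ≤ δ}

/-- `f^δ(I)` where `I = [c, c + √(δ/t)]`: a `(δ,t)`-rectangle with left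
endpoint `c`. -/
noncomputable def rectSet (f : ℝ → ℝ) (δ t c : ℝ) : Set (ℝ × ℝ) :=
  rectOn f δ (Set.Icc c (c + Real.sqrt (δ / t)))

/-- `R` is a `(δ,t)`-rectangle `f^δ(I)` with `f ∈ 𝓖` and `I ⊆ Jsub` an
interval of length `√(δ/t)`. -/
def IsRect (𝓖 : Set (ℝ → ℝ)) (Jsub : Set ℝ) (δ t : ℝ) (R : Set (ℝ × ℝ)) : Prop :=
  ∃ f ∈ 𝓖, ∃ c : ℝ, Set.Icc c (c + Real.sqrt (δ / t)) ⊆ Jsub ∧ R = rectSet f δ t c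

/-- Two rectangles are `λ`-comparable if some `(λδ,t)`-rectangle (with
function from `𝓖` over an interval in `J`) contains their union. -/
def Comparable (𝓖 : Set (ℝ → ℝ)) (J : Set ℝ) (δ t lam : ℝ) (R R' : Set (ℝ × ℝ)) : Prop :=
  ∃ R'' : Set (ℝ × ℝ), IsRect 𝓖 J (lam * δ) t R'' ∧ R ∪ R' ⊆ R''

/-- `f^s`, the vertical `s`-neighborhood of the graph of `f` over `J`. -/
def vtube (J : Set ℝ) (f : ℝ → ℝ) (s : ℝ) : Set (ℝ × ℝ) :=
  {p : ℝ × ℝ | p.1 ∈ J ∧ |f p.1 - p.2| ≤ s}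

/-- `R` is `λ`-tangent to `f`: `R ⊆ f^{λδ}`. -/
def Tangent (J : Set ℝ) (δ lam : ℝ) (f : ℝ → ℝ) (R : Set (ℝ × ℝ)) : Prop :=
  R ⊆ vtube J f (lam * δ)

/-- A family of cinematic functions over `J` with cinematic constant `K`. -/
def CinematicFamily (J : Set ℝ) (K : ℝ) (𝓕 : Set (ℝ → ℝ)) : Prop :=
  (∀ f ∈ 𝓕, ContDiff ℝ 2 f) ∧
  (∀ f ∈ 𝓕, ∀ g ∈ 𝓕, c2dist J f g ≤ K) ∧
  (∀ f ∈ 𝓕, ∀ g ∈ 𝓕, ∀ θ ∈ J, K⁻¹ * c2dist J f g ≤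
      |f θ - g θ| + |deriv f θ - deriv g θ| + |deriv (deriv f) θ - deriv (deriv g) θ|)



lemma aux_deriv (h : ℝ → ℝ) (hh : ContDiff ℝ 2 h) :
    Differentiable ℝ h ∧ Differentiable ℝ (deriv h) ∧ Continuous (deriv h) ∧
      Continuous (deriv (deriv h)) := by
  have h1 : ContDiff ℝ 1 (deriv h) := by
    have : ContDiff ℝ (1 + 1) h := by
      convert hh using 1; norm_num
    exact (contDiff_succ_iff_deriv.1 this).2.2
  refine ⟨hh.differentiable (by norm_num), h1.differentiable (by norm_num), h1.continuous, ?_⟩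
  exact h1.continuous_deriv (by norm_num)

/-- mean value inequality on an order-connected piece -/
lemma aux_mvi (u : ℝ → ℝ) (hu : Differentiable ℝ u) (a b D x y : ℝ)
    (hD : ∀ z ∈ Icc a b, |deriv u z| ≤ D) (hx : x ∈ Icc a b) (hy : y ∈ Icc a b) :
    |u y - u x| ≤ D * |y - x| := by
  have := (convex_Icc a b).norm_image_sub_le_of_norm_deriv_le (f := u) (C := D)
    (fun z _ => hu z) (fun z hz => hD z hz) hx hy
  simpa [Real.norm_eq_abs] using this

lemma aux_mvt (u : ℝ → ℝ) (hu : Differentiable ℝ u) (x y : ℝ) (hxy : x < y) :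
    ∃ z ∈ Ioo x y, u y - u x = deriv u z * (y - x) := by
  obtain ⟨z, hz, h⟩ := exists_deriv_eq_slope u hxy hu.continuous.continuousOn
    hu.differentiableOn
  refine ⟨z, hz, ?_⟩
  rw [h, div_mul_cancel₀]
  linarith

lemma aux_second (h : ℝ → ℝ) (hh : ContDiff ℝ 2 h) (c l E : ℝ) (hl : 0 < l)
    (hE : ∀ x ∈ Icc c (c + l), |h x| ≤ E) :
    ∃ ξ ∈ Icc c (c + l), |deriv (deriv h) ξ| * l ^ 2 ≤ 16 * E := by
  obtain ⟨d1, d2, -, -⟩ := aux_deriv h hh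
  have hφ : ∀ x, HasDerivAt (fun x => h (x + l / 2) - h x)
      (deriv h (x + l / 2) - deriv h x) x := by
    intro x
    exact ((d1 _).hasDerivAt.comp_add_const x (l / 2)).sub (d1 x).hasDerivAt
  obtain ⟨x, hx, e1⟩ := aux_mvt (fun x => h (x + l / 2) - h x)
    (fun x => (hφ x).differentiableAt) c (c + l / 2) (by linarith)
  rw [(hφ x).deriv] at e1
  obtain ⟨ξ, hξ, e2⟩ := aux_mvt (deriv h) d2 x (x + l / 2) (by linarith)
  refine ⟨ξ, ⟨by linarith [hx.1, hξ.1], by linarith [hx.2, hξ.2]⟩, ?_⟩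
  rw [e2] at e1
  have b1 := abs_le.1 (hE c ⟨by linarith, by linarith⟩)
  have b2 := abs_le.1 (hE (c + l / 2) ⟨by linarith, by linarith⟩)
  have b3 := abs_le.1 (hE (c + l / 2 + l / 2) ⟨by linarith, by linarith⟩)
  have e3 : deriv (deriv h) ξ * l ^ 2 =
      4 * (h (c + l / 2 + l / 2) - h (c + l / 2) - (h (c + l / 2) - h c)) := by
    rw [e1]; ring
  have : |deriv (deriv h) ξ * l ^ 2| ≤ 16 * E := by
    rw [e3, abs_le]; constructor <;> linarith
  rwa [abs_mul, abs_of_pos (by positivity : (0:ℝ) < l ^ 2)] at this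

lemma aux_landau (h : ℝ → ℝ) (hh : ContDiff ℝ 2 h) (c l E D s : ℝ)
    (hE : ∀ x ∈ Icc c (c + l), |h x| ≤ E)
    (hD : ∀ x ∈ Icc c (c + l), |deriv (deriv h) x| ≤ D) (hs : 0 < s) (hsl : s ≤ l / 2)
    (x : ℝ) (hx : x ∈ Icc c (c + l)) : |deriv h x| * s ≤ 2 * E + D * s ^ 2 := by
  obtain ⟨d1, d2, -, -⟩ := aux_deriv h hh
  have key : ∀ p q, p ∈ Icc c (c + l) → q ∈ Icc c (c + l) → q - p = s → x ∈ Icc p q →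
      |deriv h x| * s ≤ 2 * E + D * s ^ 2 := by
    intro p q hp hq hpq hxpq
    obtain ⟨z, hz, e⟩ := aux_mvt h d1 p q (by linarith)
    have hD0 : 0 ≤ D := (abs_nonneg _).trans (hD x hx)
    have hzI : z ∈ Icc c (c + l) := ⟨by linarith [hp.1, hz.1], by linarith [hq.2, hz.2]⟩
    have h1 := aux_mvi (deriv h) d2 c (c + l) D z x hD hzI hx
    have h2 : |x - z| ≤ s := by
      rw [abs_le]; constructor <;> linarith [hxpq.1, hxpq.2, hz.1, hz.2]
    have h3 : |deriv h z| * s ≤ 2 * E := by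
      rw [hpq] at e
      have : |deriv h z * s| ≤ 2 * E := by
        rw [← e, abs_le]
        have := abs_le.1 (hE p hp)
        have := abs_le.1 (hE q hq)
        constructor <;> linarith
      rwa [abs_mul, abs_of_pos hs] at this
    have h4 : |deriv h x| ≤ |deriv h z| + D * s := by
      have := abs_sub_abs_le_abs_sub (deriv h x) (deriv h z)
      have := mul_le_mul_of_nonneg_left h2 hD0
      linarith
    have := mul_le_mul_of_nonneg_right h4 hs.le
    nlinarith
  by_cases hc : x ≤ c + l / 2
  · exact key x (x + s) hx ⟨by linarith [hx.1], by linarith⟩ (by ring) ⟨le_rfl, by linarith⟩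
  · push Not at hc
    exact key (x - s) x ⟨by linarith, by linarith [hx.2]⟩ hx (by ring) ⟨by linarith, le_rfl⟩

/-- smallness on one interval forces the `C²` norm to be `O(t)` -/
lemma aux_D (h : ℝ → ℝ) (hh : ContDiff ℝ 2 h) (c l t C K D : ℝ) (hl : 0 < l) (hl1 : l ≤ 1)
    (ht : 0 < t) (hC : 0 ≤ C) (hK : 1 ≤ K)
    (hE : ∀ x ∈ Icc c (c + l), |h x| ≤ C * (t * l ^ 2))
    (hD : ∀ x ∈ Icc c (c + l), |deriv (deriv h) x| ≤ D)
    (hcin : ∀ x ∈ Icc c (c + l), K⁻¹ * D ≤ |h x| + |deriv h x| + |deriv (deriv h) x|) :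
    D ≤ 42 * K ^ 2 * C * t := by
  obtain ⟨ξ, hξ, h1⟩ := aux_second h hh c l _ hl hE
  have hK0 : 0 < K := by linarith
  have h2 := aux_landau h hh c l _ D (l / (2 * K)) hE hD (by positivity)
    (by apply div_le_div_of_nonneg_left hl.le (by norm_num); linarith) ξ hξ
  have h3 := hE ξ hξ
  have h4 := hcin ξ hξ
  have hD0 : 0 ≤ D := (abs_nonneg _).trans (hD ξ hξ)
  have g1 : |deriv (deriv h) ξ| ≤ 16 * C * t := by
    have : |deriv (deriv h) ξ| * l ^ 2 ≤ (16 * C * t) * l ^ 2 := by linarith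
    exact le_of_mul_le_mul_right this (by positivity)
  have g2 : |deriv h ξ| ≤ 4 * K * C * t * l + D * l / (2 * K) := by
    have e : 2 * (C * (t * l ^ 2)) + D * (l / (2 * K)) ^ 2 =
      (4 * K * C * t * l + D * l / (2 * K)) * (l / (2 * K)) := by
      field_simp; ring
    rw [e] at h2
    exact le_of_mul_le_mul_right h2 (by positivity)
  have g3 : |h ξ| ≤ C * t := by
    refine h3.trans ?_
    have : l ^ 2 ≤ 1 := pow_le_one₀ hl.le hl1
    have : t * l ^ 2 ≤ t := by nlinarith
    exact mul_le_mul_of_nonneg_left this hC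
  have g4 : 4 * K * C * t * l ≤ 4 * K * C * t := by
    apply mul_le_of_le_one_right (by positivity) hl1
  have g5 : D * l / (2 * K) ≤ D / (2 * K) := by
    gcongr
    exact mul_le_of_le_one_right hD0 hl1
  have g6 : K⁻¹ * D ≤ C * t + (4 * K * C * t + D / (2 * K)) + 16 * C * t := by linarith
  have g7 : D / (2 * K) ≤ 17 * C * t + 4 * K * C * t := by
    have : K⁻¹ * D = D / (2 * K) + D / (2 * K) := by field_simp; ring
    linarith
  rw [div_le_iff₀ (by positivity)] at g7
  have : 34 * (C * t * K) ≤ 34 * (C * t * K) * K :=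
    le_mul_of_one_le_right (by positivity) hK
  nlinarith

lemma aux_bound (h : ℝ → ℝ) (hh : ContDiff ℝ 2 h) (a b c l t C K D lam : ℝ)
    (hl : 0 < l) (hl1 : l ≤ 1)
    (ht : 0 < t) (hC : 0 ≤ C) (hK : 1 ≤ K) (hlam : 0 ≤ lam)
    (hI : Icc c (c + l) ⊆ Icc a b)
    (hE : ∀ x ∈ Icc c (c + l), |h x| ≤ C * (t * l ^ 2))
    (hD : ∀ x ∈ Icc a b, |deriv (deriv h) x| ≤ D)
    (hcin : ∀ x ∈ Icc a b, K⁻¹ * D ≤ |h x| + |deriv h x| + |deriv (deriv h) x|)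
    (x : ℝ) (hx : x ∈ Icc a b) (hxc : |x - c| ≤ lam * l) :
    |deriv h x| ≤ (2 * C + 42 * K ^ 2 * C * (lam + 1)) * (t * l) ∧
    |h x| ≤ (C + (2 * C + 42 * K ^ 2 * C * (lam + 1)) * lam) * (t * l ^ 2) := by
  obtain ⟨d1, d2, -, -⟩ := aux_deriv h hh
  have hDA := aux_D h hh c l t C K D hl hl1 ht hC hK hE (fun x hx => hD x (hI hx))
    (fun x hx => hcin x (hI hx))
  obtain ⟨ξ, hξ, e⟩ := aux_mvt h d1 c (c + l) (by linarith)
  have hcI : c ∈ Icc c (c + l) := ⟨le_rfl, by linarith⟩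
  have hD0 : 0 ≤ D := (abs_nonneg _).trans (hD x hx)
  have hξ' : |deriv h ξ| ≤ 2 * C * (t * l) := by
    have : |deriv h ξ * l| ≤ 2 * C * (t * l) * l := by
      have e' : deriv h ξ * l = h (c + l) - h c := by rw [e]; ring
      rw [e', abs_le]
      have := abs_le.1 (hE c hcI)
      have := abs_le.1 (hE (c + l) ⟨by linarith, le_rfl⟩)
      constructor <;> nlinarith
    rw [abs_mul, abs_of_pos hl] at this
    exact le_of_mul_le_mul_right this hl
  have main : ∀ y ∈ Icc a b, |y - c| ≤ lam * l →
      |deriv h y| ≤ (2 * C + 42 * K ^ 2 * C * (lam + 1)) * (t * l) := by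
    intro y hy hyc
    have h1 := aux_mvi (deriv h) d2 a b D ξ y hD (hI ⟨hξ.1.le, hξ.2.le⟩) hy
    have h2 : |y - ξ| ≤ (lam + 1) * l := by
      have := abs_le.1 hyc
      rw [abs_le]; constructor <;> linarith [hξ.1, hξ.2]
    have h3 : D * |y - ξ| ≤ (42 * K ^ 2 * C * t) * ((lam + 1) * l) := by
      gcongr
    have := abs_sub_abs_le_abs_sub (deriv h y) (deriv h ξ)
    nlinarith
  refine ⟨main x hx hxc, ?_⟩
  have hca := hI hcI
  have hcc : c ∈ Icc (min c x) (max c x) := ⟨min_le_left _ _, le_max_left _ _⟩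
  have hxx : x ∈ Icc (min c x) (max c x) := ⟨min_le_right _ _, le_max_right _ _⟩
  have h1 := aux_mvi h d1 (min c x) (max c x)
    ((2 * C + 42 * K ^ 2 * C * (lam + 1)) * (t * l)) c x
    (by
      intro z hz
      refine main z ⟨(le_min hca.1 hx.1).trans hz.1, hz.2.trans (max_le hca.2 hx.2)⟩ ?_
      exact (abs_sub_left_of_mem_uIcc (a := c) (b := x) hz).trans hxc) hcc hxx
  have h2 := hE c hcI
  have h3 : (2 * C + 42 * K ^ 2 * C * (lam + 1)) * (t * l) * |x - c| ≤
      (2 * C + 42 * K ^ 2 * C * (lam + 1)) * (t * l) * (lam * l) := by gcongr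
  have := abs_sub_abs_le_abs_sub (h x) (h c)
  nlinarith

lemma aux_c2 (a b : ℝ) (f g : ℝ → ℝ) (hf : ContDiff ℝ 2 f) (hg : ContDiff ℝ 2 g)
    (x : ℝ) (hx : x ∈ Icc a b) :
    |deriv (deriv f) x - deriv (deriv g) x| ≤ c2dist (Icc a b) f g := by
  obtain ⟨d1, d2, c1, c2⟩ := aux_deriv f hf
  obtain ⟨d1', d2', c1', c2'⟩ := aux_deriv g hg
  have hc : Continuous (fun θ => |f θ - g θ| + |deriv f θ - deriv g θ| +
      |deriv (deriv f) θ - deriv (deriv g) θ|) := by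
    have := d1.continuous
    have := d1'.continuous
    fun_prop
  have hb := (isCompact_Icc (a := a) (b := b)).bddAbove_image hc.continuousOn
  have := le_csSup hb (mem_image_of_mem _ hx)
  unfold c2dist
  refine le_trans ?_ this
  have := abs_nonneg (f x - g x)
  have := abs_nonneg (deriv f x - deriv g x)
  linarith

lemma aux_bound2 (a b K : ℝ) (hK : 1 ≤ K) (F : Set (ℝ → ℝ)) (hF : CinematicFamily (Icc a b) K F)
    (f g : ℝ → ℝ) (hf : f ∈ F) (hg : g ∈ F) (c l t C lam : ℝ)
    (hl : 0 < l) (hl1 : l ≤ 1) (ht : 0 < t) (hC : 0 ≤ C) (hlam : 0 ≤ lam)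
    (hI : Icc c (c + l) ⊆ Icc a b)
    (hE : ∀ x ∈ Icc c (c + l), |f x - g x| ≤ C * (t * l ^ 2))
    (x : ℝ) (hx : x ∈ Icc a b) (hxc : |x - c| ≤ lam * l) :
    |deriv f x - deriv g x| ≤ (2 * C + 42 * K ^ 2 * C * (lam + 1)) * (t * l) ∧
    |f x - g x| ≤ (C + (2 * C + 42 * K ^ 2 * C * (lam + 1)) * lam) * (t * l ^ 2) := by
  obtain ⟨h1, -, h3⟩ := hF
  obtain ⟨d1, d2, c1, c2⟩ := aux_deriv f (h1 f hf)
  obtain ⟨d1', d2', c1', c2'⟩ := aux_deriv g (h1 g hg)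
  have e1 : deriv (fun x => f x - g x) = fun x => deriv f x - deriv g x := by
    ext y; exact deriv_fun_sub (d1 y) (d1' y)
  have e2 : deriv (deriv (fun x => f x - g x)) =
      fun x => deriv (deriv f) x - deriv (deriv g) x := by
    rw [e1]; ext y; exact deriv_fun_sub (d2 y) (d2' y)
  have := aux_bound (fun x => f x - g x) ((h1 f hf).sub (h1 g hg)) a b c l t C K
    (c2dist (Icc a b) f g) lam hl hl1 ht hC hK hlam hI hE
    (by rw [e2]; exact fun x hx => aux_c2 a b f g (h1 f hf) (h1 g hg) x hx)
    (by rw [e2, e1]; exact h3 f hf g hg) x hx hxc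
  rw [e1] at this
  exact this

lemma aux_indep {α : Type*} (S : Set α) (hS : S.Finite) (r : α → α → Prop)
    (hr : ∀ x y, r x y → r y x) (N : ℕ)
    (hN : ∀ x ∈ S, {y ∈ S | r x y}.ncard ≤ N) :
    ∃ T ⊆ S, (∀ x ∈ T, ∀ y ∈ T, x ≠ y → ¬ r x y) ∧ S.ncard ≤ (N + 1) * T.ncard := by
  classical
  have hfin : {T : Set α | T ⊆ S ∧ ∀ x ∈ T, ∀ y ∈ T, x ≠ y → ¬ r x y}.Finite :=
    hS.finite_subsets.subset (fun T hT => hT.1)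
  obtain ⟨T, hT⟩ := hfin.exists_maximal ⟨∅, by simp⟩
  obtain ⟨⟨hTS, hT1⟩, hmax⟩ := hT
  refine ⟨T, hTS, hT1, ?_⟩
  have hTf := hS.subset hTS
  have hcov : S ⊆ ⋃ x ∈ hTf.toFinset, insert x {y ∈ S | r x y} := by
    intro y hy
    simp only [mem_iUnion, Finite.mem_toFinset]
    by_cases hyT : y ∈ T
    · exact ⟨y, hyT, mem_insert _ _⟩
    by_contra hcon
    push Not at hcon
    have hno : ∀ x ∈ T, ¬ r x y := fun x hx h => hcon x hx (mem_insert_of_mem _ ⟨hy, h⟩)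
    refine hyT (hmax (y := insert y T) ⟨insert_subset hy hTS, ?_⟩ (subset_insert _ _)
      (mem_insert _ _))
    rintro x (rfl | hx) z (rfl | hz) hxz
    · exact absurd rfl hxz
    · exact fun h => hno z hz (hr _ _ h)
    · exact hno x hx
    · exact hT1 x hx z hz hxz
  have hfin2 : (⋃ x ∈ hTf.toFinset, insert x {y ∈ S | r x y}).Finite := by
    refine hS.subset (iUnion₂_subset fun x hx => ?_)
    exact insert_subset (hTS (by simpa using hx)) (sep_subset _ _)
  calc S.ncard ≤ (⋃ x ∈ hTf.toFinset, insert x {y ∈ S | r x y}).ncard :=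
        ncard_le_ncard hcov hfin2
    _ ≤ ∑ x ∈ hTf.toFinset, (insert x {y ∈ S | r x y}).ncard :=
        Finset.set_ncard_biUnion_le _ _
    _ ≤ ∑ x ∈ hTf.toFinset, (N + 1) := by
        refine Finset.sum_le_sum fun x hx => ?_
        have := hN x (hTS (by simpa using hx))
        have := ncard_insert_le x {y ∈ S | r x y}
        omega
    _ = (N + 1) * T.ncard := by
        rw [Finset.sum_const, ncard_eq_toFinset_card T hTf, smul_eq_mul, mul_comm]

lemma aux_clamp (a b x y : ℝ) : |max a (min b x) - max a (min b y)| ≤ |x - y| := by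
  have h1 := abs_max_sub_max_le_abs (min b x) (min b y) a
  have h2 := abs_min_sub_min_le_max b x b y
  rw [max_comm a, max_comm a]
  refine h1.trans (h2.trans ?_)
  simp

lemma aux_floor (u v : ℝ) (h : ⌊u⌋ = ⌊v⌋) : |u - v| ≤ 1 :=
  (Int.abs_sub_lt_one_of_floor_eq_floor h).le

lemma aux_floor_mem (u : ℝ) (P : ℕ) (h : |u| ≤ P) : ⌊u⌋ ∈ Finset.Icc (-(P:ℤ)) P := by
  rw [Finset.mem_Icc]
  obtain ⟨h1, h2⟩ := abs_le.1 h
  constructor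
  · rw [Int.le_floor]; push_cast; exact h1
  · have : (⌊u⌋ : ℝ) ≤ (P : ℤ) := by push_cast; exact (Int.floor_le u).trans h2
    exact_mod_cast this

/-- The degree bound, for normalised parameters. `n` is the grid fineness. -/
lemma aux_degree (K C : ℝ) (hK : 1 ≤ K) (hC : 100 ≤ C) (B : ℝ)
    (hB : B = 2 * (C + (2 * C + 42 * K ^ 2 * C * ((2 * C + 2) + 1)) * (2 * C + 2)))
    (L n P : ℕ) (hL : C + 1 ≤ L) (hL2 : (L:ℝ) ≤ C + 2) (hn : 2 * B ≤ n) (hPB : B ≤ P)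
    (a b : ℝ) (F : Set (ℝ → ℝ)) (hF : CinematicFamily (Icc a b) K F)
    (t l : ℝ) (hl : 0 < l) (hl1 : l ≤ 1) (ht : 0 < t)
    (S : Set (Set (ℝ × ℝ)))
    (hS : ∀ R ∈ S, ∃ f ∈ F, ∃ c : ℝ, Icc c (c + l) ⊆ Icc a b ∧
      R = rectOn f (t * l ^ 2) (Icc c (c + l)))
    (hinc : ∀ R ∈ S, ∀ R' ∈ S, R ≠ R' → ¬ ∃ f ∈ F, ∃ c : ℝ, Icc c (c + 10 * l) ⊆ Icc a b ∧
      R ∪ R' ⊆ rectOn f (100 * (t * l ^ 2)) (Icc c (c + 10 * l)))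
    (r : Set (ℝ × ℝ) → Set (ℝ × ℝ) → Prop)
    (hr : ∀ R R', r R R' → ∃ f ∈ F, ∃ c : ℝ, Icc c (c + √C * l) ⊆ Icc a b ∧
      R ∪ R' ⊆ rectOn f (C * (t * l ^ 2)) (Icc c (c + √C * l)))
    (R : Set (ℝ × ℝ)) (hR : R ∈ S) :
    {R' ∈ S | r R R'}.ncard ≤ (Finset.Icc (-(P:ℤ)) P ×ˢ
      Fintype.piFinset (fun _ : Fin (2 * L * n + 1) => Finset.Icc (-(P:ℤ)) P)).card := by
  classical
  have hC0 : 0 ≤ C := by linarith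
  have hs10 : 10 ≤ √C := Real.le_sqrt_of_sq_le (by linarith)
  have hsC : √C ≤ C := by
    rw [Real.sqrt_le_left hC0]; nlinarith
  have hCC : 0 ≤ 42 * K ^ 2 * C * ((2 * C + 2) + 1) := by positivity
  have hBC : C ≤ B := by
    have : 0 ≤ (2 * C + 42 * K ^ 2 * C * ((2 * C + 2) + 1)) * (2 * C + 2) := by positivity
    linarith
  obtain ⟨f, hf, c, hcI, rfl⟩ := hS R hR
  have hδ : 0 < t * l ^ 2 := by positivity
  have hcJ : c ∈ Icc a b := hcI ⟨le_rfl, by linarith⟩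
  choose! ff hff cc hcc hRR using hS
  -- basic facts on neighbours
  have fact : ∀ R' ∈ S, r (rectOn f (t * l ^ 2) (Icc c (c + l))) R' →
      |cc R' - c| ≤ C * l ∧ 10 * l ≤ b - a ∧
      ∀ x ∈ Icc a b, |x - c| ≤ L * l → |ff R' x - f x| ≤ B * (t * l ^ 2) ∧
        |deriv (ff R') x - deriv f x| ≤ B * (t * l) := by
    intro R' hR' hrR
    obtain ⟨g, hg, c'', hc'', hsub⟩ := hr _ _ hrR
    have hsl : 0 < √C * l := by positivity
    have hin1 : ∀ x ∈ Icc c (c + l), x ∈ Icc c'' (c'' + √C * l) ∧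
        |f x - g x| ≤ C * (t * l ^ 2) := by
      intro x hx
      exact hsub (Or.inl (show (x, f x) ∈ _ from ⟨hx, by simpa using hδ.le⟩))
    have hin2 : ∀ x ∈ Icc (cc R') (cc R' + l), x ∈ Icc c'' (c'' + √C * l) ∧
        |ff R' x - g x| ≤ C * (t * l ^ 2) := by
      intro x hx
      refine hsub (Or.inr (show (x, ff R' x) ∈ _ from ?_))
      have hm : (x, ff R' x) ∈ rectOn (ff R') (t * l ^ 2) (Icc (cc R') (cc R' + l)) :=
        ⟨hx, by simpa using hδ.le⟩
      rwa [← hRR R' hR'] at hm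
    have hle : √C * l ≤ C * l := by gcongr
    have hcc1 : |cc R' - c| ≤ C * l := by
      have h1 := (hin1 c ⟨le_rfl, by linarith⟩).1
      have h2 := (hin2 (cc R') ⟨le_rfl, by linarith⟩).1
      rw [abs_le]; constructor <;> linarith [h1.1, h1.2, h2.1, h2.2]
    refine ⟨hcc1, ?_, ?_⟩
    · have h1 := (hc'' (⟨le_rfl, by linarith⟩ : c'' ∈ Icc c'' (c'' + √C * l))).1
      have h2 := (hc'' (⟨by linarith, le_rfl⟩ : c'' + √C * l ∈ Icc c'' (c'' + √C * l))).2
      nlinarith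
    · intro x hx hxc
      have hLl : (L:ℝ) * l ≤ (C + 2) * l := by gcongr
      have b1 := aux_bound2 a b K hK F hF f g hf hg c l t C (2 * C + 2) hl hl1 ht hC0
        (by linarith) hcI (fun x hx => (hin1 x hx).2) x hx (by nlinarith)
      have b2 := aux_bound2 a b K hK F hF (ff R') g (hff R' hR') hg (cc R') l t C (2 * C + 2)
        hl hl1 ht hC0 (by linarith) (hcc R' hR') (fun x hx => (hin2 x hx).2) x hx (by
          have e : x - cc R' = (x - c) - (cc R' - c) := by ring
          rw [e]
          refine (abs_sub _ _).trans ?_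
          linarith)
      set Q := 2 * C + 42 * K ^ 2 * C * ((2 * C + 2) + 1) with hQ
      have hQ0 : 0 ≤ Q := by positivity
      have hQB : 2 * Q ≤ B := by nlinarith
      constructor
      · have e : ff R' x - f x = (ff R' x - g x) - (f x - g x) := by ring
        rw [e]
        refine (abs_sub _ _).trans ?_
        rw [hB]; linarith [b1.2, b2.2]
      · have e : deriv (ff R') x - deriv f x =
          (deriv (ff R') x - deriv g x) - (deriv f x - deriv g x) := by ring
        rw [e]
        refine (abs_sub _ _).trans ?_
        have : 2 * Q * (t * l) ≤ B * (t * l) := by gcongr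
        linarith [b1.1, b2.1]
  -- grid
  have hn0 : 0 < (n : ℝ) := by linarith
  set p : Fin (2 * L * n + 1) → ℝ := fun k => max a (min b (c + ((k:ℕ) / (n:ℝ) - L) * l)) with hp
  have hab : a ≤ b := hcJ.1.trans hcJ.2
  have clampid : ∀ x ∈ Icc a b, max a (min b x) = x := by
    intro x hx
    rw [min_eq_right hx.2, max_eq_right hx.1]
  have hpJ : ∀ k, p k ∈ Icc a b := fun k =>
    ⟨le_max_left _ _, max_le hab (min_le_left _ _)⟩
  have hpc : ∀ k, |p k - c| ≤ L * l := by
    intro k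
    have h1 := aux_clamp a b (c + ((k:ℕ) / (n:ℝ) - L) * l) c
    rw [clampid c hcJ] at h1
    refine h1.trans ?_
    have hk : ((k:ℕ):ℝ) ≤ 2 * L * n := by
      exact_mod_cast Nat.lt_succ_iff.1 k.2
    have hk1 : ((k:ℕ):ℝ) / n ≤ 2 * L := by
      rw [div_le_iff₀ hn0]; exact hk
    have hk0 : 0 ≤ ((k:ℕ):ℝ) / n := by positivity
    rw [add_sub_cancel_left, abs_mul, abs_of_pos hl]
    gcongr
    rw [abs_le]; constructor <;> linarith
  have hgrid : ∀ x ∈ Icc a b, |x - c| ≤ L * l → ∃ k, |x - p k| ≤ l / n := by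
    intro x hx hxc
    have hxc' := abs_le.1 hxc
    have h0 : 0 ≤ ((x - c) / l + L) * n := by
      have : -(L:ℝ) ≤ (x - c) / l := by rw [le_div_iff₀ hl]; linarith
      have : 0 ≤ (x - c) / l + L := by linarith
      positivity
    have h1 : ((x - c) / l + L) * n ≤ (2 * L * n : ℕ) := by
      have : (x - c) / l ≤ L := by rw [div_le_iff₀ hl]; linarith
      push_cast
      gcongr
      linarith
    have h2 := Nat.floor_le h0
    have h3 := Nat.lt_floor_add_one (((x - c) / l + L) * n)
    have h4 : ⌊((x - c) / l + L) * n⌋₊ < 2 * L * n + 1 := by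
      have := Nat.floor_le_of_le h1
      omega
    refine ⟨⟨_, h4⟩, ?_⟩
    have h5 := aux_clamp a b x (c + ((⌊((x - c) / l + L) * n⌋₊ : ℝ) / (n:ℝ) - L) * l)
    rw [clampid x hx] at h5
    refine h5.trans ?_
    have e : x - (c + ((⌊((x - c) / l + L) * n⌋₊ : ℝ) / (n:ℝ) - L) * l) =
      (((x - c) / l + L) * n - ⌊((x - c) / l + L) * n⌋₊) * (l / n) := by
      field_simp
      ring
    rw [e, abs_mul, abs_of_nonneg (by linarith), abs_of_pos (by positivity : 0 < l / n)]
    apply mul_le_of_le_one_left (by positivity)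
    linarith
  set code : Set (ℝ × ℝ) → ℤ × (Fin (2 * L * n + 1) → ℤ) := fun R' =>
    (⌊(cc R' - c) / l⌋, fun k => ⌊(ff R' (p k) - f (p k)) / (t * l ^ 2)⌋) with hcode
  rw [← ncard_coe_finset]
  refine ncard_le_ncard_of_injOn code ?_ ?_ (Finset.finite_toSet _)
  · rintro R' ⟨hR', hrR⟩
    obtain ⟨f1, -, f3⟩ := fact R' hR' hrR
    rw [Finset.mem_coe, Finset.mem_product, Fintype.mem_piFinset]
    refine ⟨aux_floor_mem _ _ ?_, fun k => aux_floor_mem _ _ ?_⟩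
    · rw [abs_div, abs_of_pos hl, div_le_iff₀ hl]
      refine f1.trans ?_
      gcongr
      linarith
    · rw [abs_div, abs_of_pos hδ, div_le_iff₀ hδ]
      refine (f3 (p k) (hpJ k) (hpc k)).1.trans ?_
      gcongr
  · rintro R1 ⟨hR1, hr1⟩ R2 ⟨hR2, hr2⟩ heq
    by_contra hne
    refine hinc R1 hR1 R2 hR2 hne ?_
    obtain ⟨f1, hba, f3⟩ := fact R1 hR1 hr1
    obtain ⟨g1, -, g3⟩ := fact R2 hR2 hr2
    have heq1 : ⌊(cc R1 - c) / l⌋ = ⌊(cc R2 - c) / l⌋ := congrArg Prod.fst heq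
    have heq2 : ∀ k, ⌊(ff R1 (p k) - f (p k)) / (t * l ^ 2)⌋ =
      ⌊(ff R2 (p k) - f (p k)) / (t * l ^ 2)⌋ := fun k => congrFun (congrArg Prod.snd heq) k
    have hc12 : |cc R1 - cc R2| ≤ l := by
      have := aux_floor _ _ heq1
      rw [← sub_div, abs_div, abs_of_pos hl, div_le_iff₀ hl] at this
      simpa using this
    have hv12 : ∀ k, |ff R1 (p k) - ff R2 (p k)| ≤ t * l ^ 2 := by
      intro k
      have := aux_floor _ _ (heq2 k)
      rw [← sub_div, abs_div, abs_of_pos hδ, div_le_iff₀ hδ] at this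
      simpa using this
    have hv : ∀ x ∈ Icc a b, |x - c| ≤ L * l → |ff R1 x - ff R2 x| ≤ 2 * (t * l ^ 2) := by
      intro x hx hxc
      obtain ⟨k, hk⟩ := hgrid x hx hxc
      obtain ⟨d1, -⟩ := aux_deriv _ (hF.1 _ (hff R1 hR1))
      obtain ⟨d2, -⟩ := aux_deriv _ (hF.1 _ (hff R2 hR2))
      have hmem : ∀ y ∈ Icc a b, |y - c| ≤ L * l →
          y ∈ Icc (max a (c - L * l)) (min b (c + L * l)) := by
        intro y hy hyc
        have := abs_le.1 hyc
        exact ⟨max_le hy.1 (by linarith), le_min hy.2 (by linarith)⟩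
      have h1 := aux_mvi (fun x => ff R1 x - ff R2 x) (d1.sub d2)
        (max a (c - L * l)) (min b (c + L * l)) (2 * B * (t * l)) (p k) x (by
          intro z hz
          have hza : z ∈ Icc a b := ⟨(le_max_left _ _).trans hz.1, hz.2.trans (min_le_left _ _)⟩
          have hzc : |z - c| ≤ L * l := by
            have := (le_max_right _ _).trans hz.1
            have := hz.2.trans (min_le_right _ _)
            rw [abs_le]; constructor <;> linarith
          rw [deriv_fun_sub (d1 z) (d2 z)]
          have e : deriv (ff R1) z - deriv (ff R2) z =
            (deriv (ff R1) z - deriv f z) - (deriv (ff R2) z - deriv f z) := by ring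
          rw [e]
          refine (abs_sub _ _).trans ?_
          linarith [(f3 z hza hzc).2, (g3 z hza hzc).2])
        (hmem _ (hpJ k) (hpc k)) (hmem x hx hxc)
      have h2 : 2 * B * (t * l) * |x - p k| ≤ t * l ^ 2 := by
        have hB0 : 0 ≤ B := by linarith
        calc 2 * B * (t * l) * |x - p k| ≤ n * (t * l) * (l / n) := by gcongr
          _ = t * l ^ 2 := by field_simp
      have h3 := abs_sub_abs_le_abs_sub (ff R1 x - ff R2 x) (ff R1 (p k) - ff R2 (p k))
      linarith [hv12 k]
    have hc12' := abs_le.1 hc12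
    have hJ1 := hcc R1 hR1 (⟨le_rfl, by linarith⟩ : cc R1 ∈ Icc (cc R1) (cc R1 + l))
    have hJ1' := hcc R1 hR1 (⟨by linarith, le_rfl⟩ : cc R1 + l ∈ Icc (cc R1) (cc R1 + l))
    have hJ2 := hcc R2 hR2 (⟨le_rfl, by linarith⟩ : cc R2 ∈ Icc (cc R2) (cc R2 + l))
    have hJ2' := hcc R2 hR2 (⟨by linarith, le_rfl⟩ : cc R2 + l ∈ Icc (cc R2) (cc R2 + l))
    obtain ⟨cs, m1, m2, m3, m4, m5, m6⟩ : ∃ cs, a ≤ cs ∧ cs + 10 * l ≤ b ∧ cs ≤ cc R1 ∧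
        cs ≤ cc R2 ∧ cc R1 + l ≤ cs + 10 * l ∧ cc R2 + l ≤ cs + 10 * l := by
      refine ⟨min (min (cc R1) (cc R2)) (b - 10 * l), ?_, ?_, ?_, ?_, ?_, ?_⟩
      · exact le_min (le_min hJ1.1 hJ2.1) (by linarith)
      · linarith [min_le_right (min (cc R1) (cc R2)) (b - 10 * l)]
      · exact (min_le_left _ _).trans (min_le_left _ _)
      · exact (min_le_left _ _).trans (min_le_right _ _)
      · have : cc R1 + l - 10 * l ≤ min (min (cc R1) (cc R2)) (b - 10 * l) :=
          le_min (le_min (by linarith) (by linarith)) (by linarith [hJ1'.2])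
        linarith
      · have : cc R2 + l - 10 * l ≤ min (min (cc R1) (cc R2)) (b - 10 * l) :=
          le_min (le_min (by linarith) (by linarith)) (by linarith [hJ2'.2])
        linarith
    refine ⟨ff R1, hff R1 hR1, cs, fun x hx => ⟨m1.trans hx.1, hx.2.trans m2⟩, ?_⟩
    rintro x (hx | hx)
    · rw [hRR R1 hR1] at hx
      obtain ⟨hx1, hx2⟩ := hx
      exact ⟨⟨m3.trans hx1.1, hx1.2.trans m5⟩, by linarith⟩
    · rw [hRR R2 hR2] at hx
      obtain ⟨hx1, hx2⟩ := hx
      refine ⟨⟨m4.trans hx1.1, hx1.2.trans m6⟩, ?_⟩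
      have h1 := hv x.1 (hcc R2 hR2 hx1) (by
        have hg := abs_le.1 g1
        have : (C + 1) * l ≤ L * l := by gcongr
        rw [abs_le]; constructor <;> nlinarith [hx1.1, hx1.2])
      have h2 := abs_sub_le x.2 (ff R2 x.1) (ff R1 x.1)
      rw [abs_sub_comm (ff R2 x.1)] at h2
      linarith
/-- **Lemma 3.15** of Pramanik–Yang–Zahl: from a finite family of pairwise
`100`-incomparable `(δ,t)`-rectangles (with functions from a ball of radius
`3t` in `C²(J)`) one can extract a pairwise `C`-incomparable subfamily of
proportional cardinality. -/
theorem extract_C_incomparable_subfamily (K C : ℝ) (hK : 1 ≤ K) (hC : 100 ≤ C) :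
    ∃ c : ℝ, 0 < c ∧
    ∀ a b : ℝ, a ≤ b →
    ∀ 𝓕 : Set (ℝ → ℝ), CinematicFamily (Set.Icc a b) K 𝓕 →
    ∀ δ t : ℝ, 0 < δ → 0 < t → δ ≤ t →
    ∀ g₀ : ℝ → ℝ,
    ∀ 𝓡 : Set (Set (ℝ × ℝ)), 𝓡.Finite →
      (∀ R ∈ 𝓡, ∃ f ∈ 𝓕, c2dist (Set.Icc a b) f g₀ ≤ 3 * t ∧
        ∃ cc : ℝ, Set.Icc cc (cc + Real.sqrt (δ / t)) ⊆ Set.Icc a b ∧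
          R = rectSet f δ t cc) →
      (∀ R ∈ 𝓡, ∀ R' ∈ 𝓡, R ≠ R' → ¬ Comparable 𝓕 (Set.Icc a b) δ t 100 R R') →
      ∃ 𝓡' ⊆ 𝓡,
        (∀ R ∈ 𝓡', ∀ R' ∈ 𝓡', R ≠ R' → ¬ Comparable 𝓕 (Set.Icc a b) δ t C R R') ∧
        c * (𝓡.ncard : ℝ) ≤ (𝓡'.ncard : ℝ) := by
  classical
  obtain ⟨B, hB⟩ : ∃ B : ℝ, B =
    2 * (C + (2 * C + 42 * K ^ 2 * C * ((2 * C + 2) + 1)) * (2 * C + 2)) := ⟨_, rfl⟩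
  set L := ⌈C⌉₊ + 1 with hLdef
  have hL : C + 1 ≤ L := by
    rw [hLdef]; push_cast; linarith [Nat.le_ceil C]
  have hL2 : (L:ℝ) ≤ C + 2 := by
    rw [hLdef]; push_cast; linarith [Nat.ceil_lt_add_one (by linarith : 0 ≤ C)]
  obtain ⟨n, hn⟩ := exists_nat_ge (2 * B)
  obtain ⟨P, hP⟩ := exists_nat_ge B
  set N := (Finset.Icc (-(P:ℤ)) P ×ˢ
      Fintype.piFinset (fun _ : Fin (2 * L * n + 1) => Finset.Icc (-(P:ℤ)) P)).card with hN
  refine ⟨((N:ℝ) + 1)⁻¹, by positivity, ?_⟩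
  intro a b _ 𝓕 hF δ t hδ ht hδt g₀ 𝓡 hfin hrect hinc
  have hl : 0 < √(δ / t) := Real.sqrt_pos.2 (by positivity)
  have hl1 : √(δ / t) ≤ 1 := by
    rw [Real.sqrt_le_one, div_le_one ht]; exact hδt
  have hδl : t * √(δ / t) ^ 2 = δ := by
    rw [Real.sq_sqrt (by positivity)]; field_simp
  have hsq : ∀ s : ℝ, 0 ≤ s → √(s * δ / t) = √s * √(δ / t) := by
    intro s hs
    rw [mul_div_assoc, Real.sqrt_mul hs]
  have h10 : √(100:ℝ) = 10 := by
    rw [show (100:ℝ) = 10 ^ 2 by norm_num]; exact Real.sqrt_sq (by norm_num)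
  obtain ⟨T, hT, hT1, hT2⟩ := aux_indep 𝓡 hfin (Comparable 𝓕 (Set.Icc a b) δ t C)
    (by
      rintro x y ⟨R, h1, h2⟩
      exact ⟨R, h1, by rwa [union_comm]⟩) N
    (by
      intro R hR
      refine aux_degree K C hK hC B hB L n P hL hL2 hn hP a b 𝓕 hF t (√(δ / t)) hl hl1 ht 𝓡
        ?_ ?_ _ ?_ R hR
      · intro R hR
        obtain ⟨f, hf, -, c, hc, e⟩ := hrect R hR
        exact ⟨f, hf, c, hc, by rw [hδl]; exact e⟩
      · rintro R hR R' hR' hne ⟨f, hf, c, hc, e⟩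
        refine hinc R hR R' hR' hne ⟨_, ⟨f, hf, c, ?_, rfl⟩, ?_⟩
        · rwa [hsq _ (by norm_num), h10]
        · rw [hδl] at e
          rwa [rectSet, hsq _ (by norm_num), h10]
      · rintro R R' ⟨R'', ⟨f, hf, c, hc, rfl⟩, e⟩
        rw [rectSet, hsq _ (by linarith)] at e
        rw [hsq _ (by linarith)] at hc
        exact ⟨f, hf, c, hc, by rwa [hδl]⟩)
  refine ⟨T, hT, hT1, ?_⟩
  rw [inv_mul_le_iff₀ (by positivity)]
  exact_mod_cast hT2
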